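/- Let ρ₁ be a path in a higraph and k ≥ 1. The map (e¹₁, e²₁, …, e^k₁) ↦ (e¹₁, e²₂, …, e^k_k), defined by pushing forward the remaining breaks under the contraction bijection π at each gluing step, is a bijection between k-tuples of distinct breaks on ρ₁ and k-step gluing sequences on ρ₁. Furthermore, if two k-tuples of distinct breaks differ by a permutation, then the corresponding k-step gluing sequences terminate in the same path ρ_{k+1}. -/

import Mathlib

/-!
Statement 16: For a path ρ₁ in a higraph, pushing breaks forward along gluings gives a
bijection between k-tuples of distinct breaks on ρ₁ and k-step gluing sequences on ρ₁;
moreover tuples differing by a permutation yield gluing sequences terminating in the same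
path.
-/

open scoped Classical

noncomputable section

variable {V : Type*}

/-- Raw combinatorial data of a path in a directed hypergraph. -/
structure RawPath (V : Type*) where
  nodes : Finset ℕ
  arrows : Finset (ℕ × ℕ)
  label : ℕ → Finset V × Finset V

/-- The underlying undirected simple graph of the arrow set, on the node set. -/
def RawPath.graph (r : RawPath V) : SimpleGraph {x // x ∈ r.nodes} :=
  SimpleGraph.fromRel (fun a b => ((a : ℕ), (b : ℕ)) ∈ r.arrows)

/-- The underlying data forms a (finite) non-empty directed tree. -/
def RawPath.IsDirTree (r : RawPath V) : Prop :=
  r.nodes.Nonempty ∧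
  (∀ e ∈ r.arrows, e.1 ∈ r.nodes ∧ e.2 ∈ r.nodes ∧ e.1 ≠ e.2) ∧
  (∀ a b : ℕ, (a, b) ∈ r.arrows → (b, a) ∉ r.arrows) ∧
  r.graph.IsTree

/-- A higraph: a directed hypergraph satisfying transitivity and acyclicity. -/
structure Higraph (V : Type*) where
  E : Set (Finset V × Finset V)
  transitive : ∀ e ∈ E, ∀ e' ∈ E, (e.2 ∩ e'.1).Nonempty →
    ∃ K : V, e.2 ∩ e'.1 = {K} ∧
      Disjoint e.1 (e'.1 \ {K}) ∧ Disjoint (e.2 \ {K}) e'.2 ∧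
      (e.1 ∪ (e'.1 \ {K}), (e.2 \ {K}) ∪ e'.2) ∈ E
  acyclic : ∀ e ∈ E, ∀ e' ∈ E, (e.2 ∩ e'.1).Nonempty → (e'.2 ∩ e.1).Nonempty →
    ∃ K : V, e = ({K}, {K}) ∧ e' = ({K}, {K})

/-- `r` is a path in the higraph `H`. -/
def IsPath (H : Higraph V) (r : RawPath V) : Prop :=
  r.IsDirTree ∧
  (∀ v ∈ r.nodes, r.label v ∈ H.E) ∧
  (∀ e ∈ r.arrows, ∃ K : V, (r.label e.1).2 ∩ (r.label e.2).1 = {K}) ∧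
  (∀ e ∈ r.arrows, ∀ e' ∈ r.arrows, e ≠ e' → (e.1 = e'.1 ∨ e.2 = e'.2) →
    (r.label e.1).2 ∩ (r.label e.2).1 ≠ (r.label e'.1).2 ∩ (r.label e'.2).1)

/-- Gluing a path at a break `e`: contract the arrow `e` of the underlying tree (keeping
`e.1` as the contracted node), labeling the contracted node by the glued edge. -/
def glue (r : RawPath V) (e : ℕ × ℕ) : RawPath V where
  nodes := r.nodes.erase e.2
  arrows := (r.arrows.erase e).image (fun p =>
    (if p.1 = e.2 then e.1 else p.1, if p.2 = e.2 then e.1 else p.2))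
  label := fun x =>
    if x = e.1 then
      ((r.label e.1).1 ∪ ((r.label e.2).1 \ (r.label e.1).2),
       ((r.label e.1).2 \ (r.label e.2).1) ∪ (r.label e.2).2)
    else r.label x

/-- Isomorphism of raw paths. -/
def RawIso (r₁ r₂ : RawPath V) : Prop :=
  ∃ f : Equiv.Perm ℕ,
    (∀ x : ℕ, x ∈ r₁.nodes ↔ f x ∈ r₂.nodes) ∧
    (∀ a b : ℕ, a ∈ r₁.nodes → b ∈ r₁.nodes →
      ((a, b) ∈ r₁.arrows ↔ (f a, f b) ∈ r₂.arrows)) ∧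
    (∀ v ∈ r₁.nodes, r₂.label (f v) = r₁.label v)

/-- `l` is a gluing sequence on `r`. -/
def IsGlueSeq : RawPath V → List (ℕ × ℕ) → Prop
  | _, [] => True
  | r, e :: l => e ∈ r.arrows ∧ IsGlueSeq (glue r e) l

/-- The result of performing the gluings in the list `l`. -/
def glueIter (r : RawPath V) (l : List (ℕ × ℕ)) : RawPath V := l.foldl glue r

/-- The bijection `π` induced by gluing at the break `e`, pushing any other break of the path
forward to a break of the glued path. -/
def pushBrk (e e' : ℕ × ℕ) : ℕ × ℕ :=
  (if e'.1 = e.2 then e.1 else e'.1, if e'.2 = e.2 then e.1 else e'.2)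

/-- The map sending a `k`-tuple of distinct breaks `(e¹₁, …, e^k₁)` on a path to the
`k`-step gluing sequence `(e¹₁, e²₂, …, e^k_k)`, obtained by pushing the remaining breaks
forward under `π` at each gluing step. -/
def toSeq : List (ℕ × ℕ) → List (ℕ × ℕ)
  | [] => []
  | e :: l => e :: toSeq (l.map (pushBrk e))
termination_by l => l.length
decreasing_by simp

/-! ### Forests and pushing breaks forward -/

/-- Every arrow is a bridge: some vertex colouring is constant along all arrows but that one. -/
def BridgeForest (A : Finset (ℕ × ℕ)) : Prop :=
  ∀ e ∈ A, ∃ χ : ℕ → Prop, ¬(χ e.1 ↔ χ e.2) ∧ ∀ p ∈ A, p ≠ e → (χ p.1 ↔ χ p.2)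

theorem BridgeForest.fst_ne_snd {A : Finset (ℕ × ℕ)} (hA : BridgeForest A) {e : ℕ × ℕ}
    (he : e ∈ A) : e.1 ≠ e.2 := by
  obtain ⟨χ, h, -⟩ := hA e he
  intro h'
  exact h (by rw [h'])

theorem BridgeForest.ne_swap {A : Finset (ℕ × ℕ)} (hA : BridgeForest A) {e p : ℕ × ℕ}
    (he : e ∈ A) (hp : p ∈ A) (h₁ : p.1 = e.2) : p.2 ≠ e.1 := by
  intro h₂
  have hne : p ≠ e := by
    rintro rfl
    exact hA.fst_ne_snd he h₁
  obtain ⟨χ, h, h'⟩ := hA e he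
  have := h' p hp hne
  rw [h₁, h₂] at this
  exact h this.symm

theorem pushBrk_color {χ : ℕ → Prop} {e : ℕ × ℕ} (h : χ e.1 ↔ χ e.2) (p : ℕ × ℕ) :
    (χ (pushBrk e p).1 ↔ χ p.1) ∧ (χ (pushBrk e p).2 ↔ χ p.2) := by
  unfold pushBrk
  constructor <;> dsimp only <;> split_ifs with hp <;> simp [h, hp]

theorem BridgeForest.pushBrk_injOn {A : Finset (ℕ × ℕ)} (hA : BridgeForest A) {e : ℕ × ℕ}
    (he : e ∈ A) : Set.InjOn (pushBrk e) (A.erase e : Set (ℕ × ℕ)) := by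
  intro p hp q hq hpq
  simp only [Finset.coe_erase, Set.mem_sdiff, Finset.mem_coe, Set.mem_singleton_iff] at hp hq
  by_contra hne
  obtain ⟨χ, h, h'⟩ := hA p hp.1
  have hχ := h' e he (Ne.symm hp.2)
  have hpc := pushBrk_color hχ p
  have hqc := pushBrk_color hχ q
  rw [hpq] at hpc
  have := h' q hq.1 (Ne.symm hne)
  tauto

theorem BridgeForest.image_pushBrk {A : Finset (ℕ × ℕ)} (hA : BridgeForest A) {e : ℕ × ℕ}
    (he : e ∈ A) : BridgeForest ((A.erase e).image (pushBrk e)) := by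
  intro q hq
  obtain ⟨p, hp, rfl⟩ := Finset.mem_image.1 hq
  rw [Finset.mem_erase] at hp
  obtain ⟨χ, h, h'⟩ := hA p hp.2
  have hχ := h' e he (Ne.symm hp.1)
  have hpc := pushBrk_color hχ p
  refine ⟨χ, by tauto, fun q' hq' hne => ?_⟩
  obtain ⟨p', hp', rfl⟩ := Finset.mem_image.1 hq'
  rw [Finset.mem_erase] at hp'
  have hp'c := pushBrk_color hχ p'
  have := h' p' hp'.2 (by rintro rfl; exact hne rfl)
  tauto

theorem RawPath.IsDirTree.bridgeForest {r : RawPath V} (hr : r.IsDirTree) :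
    BridgeForest r.arrows := by
  obtain ⟨-, hmem, hasymm, htree⟩ := hr
  have hadj : ∀ p (hp : p ∈ r.arrows),
      r.graph.Adj ⟨p.1, (hmem p hp).1⟩ ⟨p.2, (hmem p hp).2.1⟩ := by
    intro p hp
    simp only [RawPath.graph, SimpleGraph.fromRel_adj, ne_eq, Subtype.mk.injEq]
    exact ⟨(hmem p hp).2.2, Or.inl hp⟩
  intro e he
  have hbr := SimpleGraph.isAcyclic_iff_forall_adj_isBridge.1 htree.isAcyclic (hadj e he)
  rw [SimpleGraph.isBridge_iff] at hbr
  set u : {x // x ∈ r.nodes} := ⟨e.1, (hmem e he).1⟩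
  set w : {x // x ∈ r.nodes} := ⟨e.2, (hmem e he).2.1⟩
  set G := r.graph \ SimpleGraph.fromEdgeSet {s(u, w)}
  refine ⟨fun x => ∃ h : x ∈ r.nodes, G.Reachable u ⟨x, h⟩, ?_, ?_⟩
  · intro h
    exact hbr (h.1 ⟨u.2, SimpleGraph.Reachable.refl u⟩).2
  · intro p hp hne
    have hG : G.Adj ⟨p.1, (hmem p hp).1⟩ ⟨p.2, (hmem p hp).2.1⟩ := by
      simp only [G, SimpleGraph.sdiff_adj, SimpleGraph.fromEdgeSet_adj]
      refine ⟨hadj p hp, fun h => ?_⟩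
      have h := h.1
      simp only [Set.mem_singleton_iff, Sym2.eq_iff, u, w, Subtype.mk.injEq] at h
      rcases h with h | h
      · exact hne (Prod.ext h.1 h.2)
      · refine hasymm p.1 p.2 hp ?_
        rw [h.1, h.2]
        exact he
    exact ⟨fun ⟨_, h⟩ => ⟨(hmem p hp).2.1, h.trans hG.reachable⟩,
      fun ⟨_, h⟩ => ⟨(hmem p hp).1, h.trans hG.symm.reachable⟩⟩

theorem glue_arrows (r : RawPath V) (e : ℕ × ℕ) :
    (glue r e).arrows = (r.arrows.erase e).image (pushBrk e) := rfl

theorem pushBrk_mem_glue {r : RawPath V} {e p : ℕ × ℕ} (hp : p ∈ r.arrows) (hne : p ≠ e) :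
    pushBrk e p ∈ (glue r e).arrows :=
  Finset.mem_image_of_mem _ (Finset.mem_erase.2 ⟨hne, hp⟩)

theorem toSeq_nil : toSeq [] = [] := by rw [toSeq]

theorem toSeq_cons (e : ℕ × ℕ) (l : List (ℕ × ℕ)) :
    toSeq (e :: l) = e :: toSeq (l.map (pushBrk e)) := by rw [toSeq]

theorem length_toSeq (l : List (ℕ × ℕ)) : (toSeq l).length = l.length := by
  induction hn : l.length generalizing l with
  | zero => simp [List.length_eq_zero_iff.1 hn, toSeq_nil]
  | succ n ih =>
    obtain _ | ⟨e, l⟩ := l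
    · simp at hn
    · rw [toSeq_cons, List.length_cons, ih _ (by simpa using hn)]

theorem eq_of_map_eq_of_injOn {α β : Type*} {f : α → β} {s : Set α} (hf : Set.InjOn f s)
    {l₁ l₂ : List α} (h₁ : ∀ x ∈ l₁, x ∈ s) (h₂ : ∀ x ∈ l₂, x ∈ s)
    (h : l₁.map f = l₂.map f) : l₁ = l₂ := by
  induction l₁ generalizing l₂ with
  | nil => exact (List.map_eq_nil_iff.1 h.symm).symm
  | cons x l₁ ih =>
    obtain _ | ⟨y, l₂⟩ := l₂
    · simp at h
    · simp only [List.map_cons, List.cons.injEq, List.forall_mem_cons] at h h₁ h₂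
      rw [hf h₁.1 h₂.1 h.1, ih h₁.2 h₂.2 h.2]

/-- A list of distinct breaks on `r`. -/
def IsBreakList (r : RawPath V) (l : List (ℕ × ℕ)) : Prop :=
  l.Nodup ∧ ∀ e ∈ l, e ∈ r.arrows

theorem IsBreakList.mem_erase_of_cons {r : RawPath V} {e : ℕ × ℕ} {l : List (ℕ × ℕ)}
    (hl : IsBreakList r (e :: l)) : ∀ p ∈ l, p ∈ (r.arrows.erase e : Set (ℕ × ℕ)) := by
  intro p hp
  have h := List.nodup_cons.1 hl.1
  rw [Finset.mem_coe, Finset.mem_erase]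
  exact ⟨by rintro rfl; exact h.1 hp, hl.2 p (List.mem_cons_of_mem _ hp)⟩

theorem IsBreakList.map_pushBrk {r : RawPath V} (hr : BridgeForest r.arrows) {e : ℕ × ℕ}
    {l : List (ℕ × ℕ)} (hl : IsBreakList r (e :: l)) :
    IsBreakList (glue r e) (l.map (pushBrk e)) := by
  have hmem := hl.mem_erase_of_cons
  refine ⟨(List.nodup_cons.1 hl.1).2.map_on fun p hp q hq h =>
    hr.pushBrk_injOn (hl.2 e (by simp)) (hmem p hp) (hmem q hq) h, ?_⟩
  simp only [List.mem_map]
  rintro _ ⟨p, hp, rfl⟩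
  exact Finset.mem_image_of_mem _ (hmem p hp)

theorem IsBreakList.isGlueSeq_toSeq {r : RawPath V} (hr : BridgeForest r.arrows)
    {l : List (ℕ × ℕ)} (hl : IsBreakList r l) : IsGlueSeq r (toSeq l) := by
  induction hn : l.length generalizing l r with
  | zero => simp [List.length_eq_zero_iff.1 hn, toSeq_nil, IsGlueSeq]
  | succ n ih =>
    obtain _ | ⟨e, l⟩ := l
    · simp at hn
    · have he : e ∈ r.arrows := hl.2 e (by simp)
      rw [toSeq_cons]
      exact ⟨he, ih (hr.image_pushBrk he) (hl.map_pushBrk hr) (by simpa using hn)⟩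

theorem IsBreakList.toSeq_inj {r : RawPath V} (hr : BridgeForest r.arrows)
    {l₁ l₂ : List (ℕ × ℕ)} (h₁ : IsBreakList r l₁) (h₂ : IsBreakList r l₂)
    (h : toSeq l₁ = toSeq l₂) : l₁ = l₂ := by
  induction hn : l₁.length generalizing l₁ l₂ r with
  | zero =>
    have hlen : l₂.length = 0 := by rw [← length_toSeq, ← h, length_toSeq, hn]
    rw [List.length_eq_zero_iff.1 hn, List.length_eq_zero_iff.1 hlen]
  | succ n ih =>
    have hlen : l₂.length = n + 1 := by rw [← length_toSeq, ← h, length_toSeq, hn]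
    obtain _ | ⟨e, l₁⟩ := l₁
    · simp at hn
    obtain _ | ⟨e', l₂⟩ := l₂
    · simp at hlen
    rw [toSeq_cons, toSeq_cons, List.cons.injEq] at h
    obtain ⟨rfl, h⟩ := h
    have he : e ∈ r.arrows := h₁.2 e (by simp)
    have hmap := ih (hr.image_pushBrk he) (h₁.map_pushBrk hr) (h₂.map_pushBrk hr) h
      (by simpa using hn)
    rw [eq_of_map_eq_of_injOn (hr.pushBrk_injOn he) h₁.mem_erase_of_cons
      h₂.mem_erase_of_cons hmap]

theorem exists_toSeq_eq {r : RawPath V} (hr : BridgeForest r.arrows) {s : List (ℕ × ℕ)}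
    (hs : IsGlueSeq r s) : ∃ l, IsBreakList r l ∧ toSeq l = s := by
  induction s generalizing r with
  | nil => exact ⟨[], by simp [IsBreakList], toSeq_nil⟩
  | cons e s ih =>
    obtain ⟨he, hs⟩ := hs
    obtain ⟨l', hl', rfl⟩ := ih (hr.image_pushBrk he) hs
    have hlift : ∀ p ∈ l', ∃ q ∈ r.arrows.erase e, pushBrk e q = p := by
      intro p hp
      simpa only [glue_arrows, Finset.mem_image] using hl'.2 p hp
    obtain ⟨l, hl, rfl⟩ : ∃ l : List (ℕ × ℕ), (∀ q ∈ l, q ∈ r.arrows.erase e) ∧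
        l.map (pushBrk e) = l' := by
      clear hl' hs ih
      induction l' with
      | nil => exact ⟨[], by simp⟩
      | cons p l' ih' =>
        obtain ⟨q, hq, rfl⟩ := hlift p (by simp)
        obtain ⟨l, hl, rfl⟩ := ih' fun p hp => hlift p (List.mem_cons_of_mem _ hp)
        exact ⟨q :: l, by simpa using ⟨by simpa using hq, by simpa using hl⟩, by simp⟩
    refine ⟨e :: l, ⟨List.nodup_cons.2 ⟨fun h => ?_, List.Nodup.of_map _ hl'.1⟩, ?_⟩,
      toSeq_cons e l⟩
    · exact (Finset.mem_erase.1 (hl e h)).1 rfl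
    · intro p hp
      rcases List.mem_cons.1 hp with rfl | hp
      · exact he
      · exact (Finset.mem_erase.1 (hl p hp)).2

/-! ### Relabelling nodes -/

/-- The permutation `σ` of node names carries `r` to `r'`. -/
structure IsRelabeling (σ : Equiv.Perm ℕ) (r r' : RawPath V) : Prop where
  nodes : r'.nodes = r.nodes.image σ
  arrows : r'.arrows = r.arrows.image (Prod.map σ σ)
  label : ∀ v ∈ r.nodes, r'.label (σ v) = r.label v

theorem IsRelabeling.rawIso {σ : Equiv.Perm ℕ} {r r' : RawPath V} (h : IsRelabeling σ r r') :
    RawIso r r' := by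
  refine ⟨σ, fun x => ?_, fun a b _ _ => ?_, h.label⟩
  · rw [h.nodes, σ.injective.mem_finset_image]
  · rw [h.arrows]
    exact ((σ.injective.prodMap σ.injective).mem_finset_image (a := (a, b))).symm

theorem RawIso.refl (r : RawPath V) : RawIso r r :=
  ⟨Equiv.refl ℕ, by simp⟩

theorem RawIso.trans {r₁ r₂ r₃ : RawPath V} (h : RawIso r₁ r₂) (h' : RawIso r₂ r₃) :
    RawIso r₁ r₃ := by
  obtain ⟨f, hn, ha, hl⟩ := h
  obtain ⟨g, hn', ha', hl'⟩ := h'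
  refine ⟨f.trans g, fun x => (hn x).trans (hn' _), fun a b hx hy => ?_, fun v hv => ?_⟩
  · exact (ha a b hx hy).trans (ha' _ _ ((hn a).1 hx) ((hn b).1 hy))
  · exact (hl' _ ((hn v).1 hv)).trans (hl v hv)

theorem pushBrk_prodMap (σ : Equiv.Perm ℕ) (e p : ℕ × ℕ) :
    pushBrk (Prod.map σ σ e) (Prod.map σ σ p) = Prod.map σ σ (pushBrk e p) := by
  simp only [pushBrk, Prod.map_fst, Prod.map_snd, σ.injective.eq_iff, Prod.map_apply,
    apply_ite σ]

theorem toSeq_map_prodMap (σ : Equiv.Perm ℕ) (l : List (ℕ × ℕ)) :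
    toSeq (l.map (Prod.map σ σ)) = (toSeq l).map (Prod.map σ σ) := by
  induction hn : l.length generalizing l with
  | zero => simp [List.length_eq_zero_iff.1 hn, toSeq_nil]
  | succ n ih =>
    obtain _ | ⟨e, l⟩ := l
    · simp at hn
    · rw [List.map_cons, toSeq_cons, toSeq_cons, List.map_cons,
        ← ih (l.map (pushBrk e)) (by simpa using hn)]
      simp only [List.map_map, Function.comp_def, pushBrk_prodMap]

theorem IsRelabeling.glue {σ : Equiv.Perm ℕ} {r r' : RawPath V} (h : IsRelabeling σ r r')
    {e : ℕ × ℕ} (h₁ : e.1 ∈ r.nodes) (h₂ : e.2 ∈ r.nodes) :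
    IsRelabeling σ (glue r e) (glue r' (Prod.map σ σ e)) := by
  refine ⟨?_, ?_, fun v hv => ?_⟩
  · change r'.nodes.erase (σ e.2) = (r.nodes.erase e.2).image σ
    rw [h.nodes, Finset.image_erase σ.injective]
  · rw [glue_arrows, glue_arrows, h.arrows,
      ← Finset.image_erase (σ.injective.prodMap σ.injective), Finset.image_image,
      Finset.image_image]
    simp only [Function.comp_def, pushBrk_prodMap]
  · have hv : v ∈ r.nodes := Finset.mem_of_mem_erase hv
    simp only [_root_.glue, Prod.map_fst, Prod.map_snd, σ.injective.eq_iff, h.label _ h₁,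
      h.label _ h₂, h.label _ hv]

/-! ### Gluing edges -/

/-- The edge obtained by gluing two edges. -/
def gluedEdge (x y : Finset V × Finset V) : Finset V × Finset V :=
  (x.1 ∪ (y.1 \ x.2), (x.2 \ y.1) ∪ y.2)

/-- The edges `x` and `y` meet in the vertex `K` and can be glued there. -/
structure MeetAt (x y : Finset V × Finset V) (K : V) : Prop where
  inter : x.2 ∩ y.1 = {K}
  source : Disjoint x.1 (y.1 \ {K})
  target : Disjoint (x.2 \ {K}) y.2

theorem gluedEdge_eq {x y : Finset V × Finset V} {K : V} (h : x.2 ∩ y.1 = {K}) :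
    gluedEdge x y = (x.1 ∪ (y.1 \ {K}), (x.2 \ {K}) ∪ y.2) := by
  rw [gluedEdge, ← h, Finset.sdiff_inter_self_left, Finset.inter_comm,
    Finset.sdiff_inter_self_left]

theorem Higraph.meetAt (H : Higraph V) {x y : Finset V × Finset V} (hx : x ∈ H.E)
    (hy : y ∈ H.E) {K : V} (h₁ : K ∈ x.2) (h₂ : K ∈ y.1) : MeetAt x y K := by
  obtain ⟨L, h, hs, ht, -⟩ := H.transitive x hx y hy ⟨K, Finset.mem_inter.2 ⟨h₁, h₂⟩⟩
  have : K ∈ ({L} : Finset V) := h ▸ Finset.mem_inter.2 ⟨h₁, h₂⟩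
  rw [Finset.mem_singleton] at this
  subst this
  exact ⟨h, hs, ht⟩

theorem Higraph.gluedEdge_mem (H : Higraph V) {x y : Finset V × Finset V} (hx : x ∈ H.E)
    (hy : y ∈ H.E) (h : (x.2 ∩ y.1).Nonempty) : gluedEdge x y ∈ H.E := by
  obtain ⟨L, h, -, -, hmem⟩ := H.transitive x hx y hy h
  rwa [gluedEdge_eq h]

theorem MeetAt.mem_target {x y : Finset V × Finset V} {K : V} (h : MeetAt x y K) :
    K ∈ x.2 :=
  (Finset.mem_inter.1 (h.inter ▸ Finset.mem_singleton_self K)).1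

theorem MeetAt.mem_source {x y : Finset V × Finset V} {K : V} (h : MeetAt x y K) :
    K ∈ y.1 :=
  (Finset.mem_inter.1 (h.inter ▸ Finset.mem_singleton_self K)).2

theorem MeetAt.notMem_source {x y : Finset V × Finset V} {K L : V} (h : MeetAt x y K)
    (hL : L ∈ x.1) (hne : L ≠ K) : L ∉ y.1 := fun hy =>
  Finset.disjoint_left.1 h.source hL (by simp [hy, hne])

theorem MeetAt.notMem_target {x y : Finset V × Finset V} {K L : V} (h : MeetAt x y K)
    (hL : L ∈ x.2) (hne : L ≠ K) : L ∉ y.2 := fun hy =>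
  Finset.disjoint_left.1 h.target (by simp [hL, hne]) hy

theorem MeetAt.eq_of_mem {x y : Finset V × Finset V} {K L : V} (h : MeetAt x y K)
    (h₁ : L ∈ x.2) (h₂ : L ∈ y.1) : L = K := by
  simpa [h.inter] using Finset.mem_inter.2 ⟨h₁, h₂⟩

theorem gluedEdge_assoc {x y z : Finset V × Finset V} {K L : V} (h : MeetAt x y K)
    (h' : MeetAt y z L) (h₁ : MeetAt (gluedEdge x y) z L) (h₂ : MeetAt x (gluedEdge y z) K) :
    gluedEdge (gluedEdge x y) z = gluedEdge x (gluedEdge y z) := by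
  rw [gluedEdge_eq h₁.inter, gluedEdge_eq h₂.inter, gluedEdge_eq h.inter, gluedEdge_eq h'.inter]
  have hK := h'.notMem_source h.mem_source
  have hL : L ∈ x.2 → L = K := fun hL => by
    by_contra hne
    exact h.notMem_target hL hne h'.mem_target
  ext v <;> simp only [Finset.mem_union, Finset.mem_sdiff, Finset.mem_singleton] <;> grind

theorem gluedEdge_right_comm {x y z : Finset V × Finset V} {K L : V} (hne : K ≠ L)
    (h : MeetAt x y K) (h' : MeetAt x z L) (h₁ : MeetAt (gluedEdge x y) z L)
    (h₂ : MeetAt (gluedEdge x z) y K) :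
    gluedEdge (gluedEdge x y) z = gluedEdge (gluedEdge x z) y := by
  rw [gluedEdge_eq h₁.inter, gluedEdge_eq h₂.inter, gluedEdge_eq h.inter, gluedEdge_eq h'.inter]
  have hL := h.notMem_target h'.mem_target hne.symm
  have hK := h'.notMem_target h.mem_target hne
  ext v <;> simp only [Finset.mem_union, Finset.mem_sdiff, Finset.mem_singleton] <;> grind

theorem gluedEdge_left_comm {x y z : Finset V × Finset V} {K L : V} (hne : K ≠ L)
    (h : MeetAt x z K) (h' : MeetAt y z L) (h₁ : MeetAt y (gluedEdge x z) L)
    (h₂ : MeetAt x (gluedEdge y z) K) :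
    gluedEdge y (gluedEdge x z) = gluedEdge x (gluedEdge y z) := by
  rw [gluedEdge_eq h₁.inter, gluedEdge_eq h₂.inter, gluedEdge_eq h.inter, gluedEdge_eq h'.inter]
  have hL : L ∉ x.1 := fun hL => h.notMem_source hL hne.symm h'.mem_source
  have hK : K ∉ y.1 := fun hK => h'.notMem_source hK hne h.mem_source
  ext v <;> simp only [Finset.mem_union, Finset.mem_sdiff, Finset.mem_singleton] <;> grind

/-! ### Gluing preserves paths -/

/-- The properties of a path needed for gluing; all of them are inherited by the glued path. -/
structure IsForestPath (H : Higraph V) (r : RawPath V) : Prop where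
  mem_nodes : ∀ e ∈ r.arrows, e.1 ∈ r.nodes ∧ e.2 ∈ r.nodes
  forest : BridgeForest r.arrows
  label_mem : ∀ v ∈ r.nodes, r.label v ∈ H.E
  meet : ∀ e ∈ r.arrows, ∃ K, MeetAt (r.label e.1) (r.label e.2) K
  meet_ne : ∀ e ∈ r.arrows, ∀ e' ∈ r.arrows, e ≠ e' → (e.1 = e'.1 ∨ e.2 = e'.2) →
    ∀ K K', MeetAt (r.label e.1) (r.label e.2) K → MeetAt (r.label e'.1) (r.label e'.2) K' →
      K ≠ K'

theorem IsPath.isForestPath {H : Higraph V} {r : RawPath V} (hr : IsPath H r) :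
    IsForestPath H r := by
  obtain ⟨htree, hlabel, hsingle, hne⟩ := hr
  have hmem : ∀ e ∈ r.arrows, e.1 ∈ r.nodes ∧ e.2 ∈ r.nodes := fun e he =>
    ⟨(htree.2.1 e he).1, (htree.2.1 e he).2.1⟩
  refine ⟨hmem, htree.bridgeForest, hlabel, fun e he => ?_, ?_⟩
  · obtain ⟨K, hK⟩ := hsingle e he
    have hK' := Finset.mem_inter.1 (hK ▸ Finset.mem_singleton_self K)
    exact ⟨K, H.meetAt (hlabel _ (hmem e he).1) (hlabel _ (hmem e he).2) hK'.1 hK'.2⟩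
  · rintro e he e' he' h h' K _ hK hK' rfl
    exact hne e he e' he' h h' (hK.inter.trans hK'.inter.symm)

theorem glue_label (r : RawPath V) (e : ℕ × ℕ) (v : ℕ) :
    (glue r e).label v =
      if v = e.1 then gluedEdge (r.label e.1) (r.label e.2) else r.label v := rfl

theorem IsForestPath.glue_label_mem {H : Higraph V} {r : RawPath V} (hr : IsForestPath H r)
    {e : ℕ × ℕ} (he : e ∈ r.arrows) : ∀ v ∈ r.nodes, (glue r e).label v ∈ H.E := by
  intro v hv
  rw [glue_label]
  split_ifs
  · obtain ⟨K, hK⟩ := hr.meet e he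
    exact H.gluedEdge_mem (hr.label_mem _ (hr.mem_nodes e he).1)
      (hr.label_mem _ (hr.mem_nodes e he).2) ⟨K, hK.inter ▸ Finset.mem_singleton_self K⟩
  · exact hr.label_mem v hv

theorem IsForestPath.glue_mem_nodes {H : Higraph V} {r : RawPath V} (hr : IsForestPath H r)
    {e : ℕ × ℕ} (he : e ∈ r.arrows) :
    ∀ p ∈ (glue r e).arrows, p.1 ∈ (glue r e).nodes ∧ p.2 ∈ (glue r e).nodes := by
  intro q hq
  obtain ⟨p, hp, rfl⟩ := Finset.mem_image.1 hq
  have hp := hr.mem_nodes p (Finset.mem_of_mem_erase hp)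
  have h := hr.forest.fst_ne_snd he
  have h' := hr.mem_nodes e he
  simp only [glue, Finset.mem_erase]
  constructor <;> split_ifs <;> tauto

theorem IsForestPath.meetAt_glue {H : Higraph V} {r : RawPath V} (hr : IsForestPath H r)
    {e p : ℕ × ℕ} (he : e ∈ r.arrows) (hp : p ∈ r.arrows) (hne : p ≠ e) {K : V}
    (hK : MeetAt (r.label p.1) (r.label p.2) K) :
    MeetAt ((glue r e).label (pushBrk e p).1) ((glue r e).label (pushBrk e p).2) K := by
  have hmem := hr.glue_mem_nodes he _ (pushBrk_mem_glue hp hne)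
  obtain ⟨L, hL⟩ := hr.meet e he
  refine H.meetAt (hr.glue_label_mem he _ (Finset.mem_of_mem_erase hmem.1))
    (hr.glue_label_mem he _ (Finset.mem_of_mem_erase hmem.2)) ?_ ?_
  · by_cases h₂ : p.1 = e.2
    · have := hK.mem_target
      rw [h₂] at this
      simp [glue_label, pushBrk, h₂, gluedEdge, this]
    · by_cases h₁ : p.1 = e.1
      · have hKt := hK.mem_target
        rw [h₁] at hKt
        have hKL := hr.meet_ne p hp e he hne (Or.inl h₁) K L hK hL
        have hKs : K ∉ (r.label e.2).1 := fun h => hKL (hL.eq_of_mem hKt h)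
        simp [glue_label, pushBrk, h₁, hr.forest.fst_ne_snd he, gluedEdge, hKt, hKs]
      · simpa [glue_label, pushBrk, h₁, h₂] using hK.mem_target
  · by_cases h₁ : p.2 = e.1
    · have := hK.mem_source
      rw [h₁] at this
      simp [glue_label, pushBrk, h₁, gluedEdge, this]
    · by_cases h₂ : p.2 = e.2
      · have hKs := hK.mem_source
        rw [h₂] at hKs
        have hKL := hr.meet_ne p hp e he hne (Or.inr h₂) K L hK hL
        have hKt : K ∉ (r.label e.1).2 := fun h => hKL (hL.eq_of_mem h hKs)
        simp [glue_label, pushBrk, h₂, gluedEdge, hKt, hKs]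
      · simpa [glue_label, pushBrk, h₁, h₂] using hK.mem_source

theorem MeetAt.unique {x y : Finset V × Finset V} {K L : V} (h : MeetAt x y K)
    (h' : MeetAt x y L) : K = L :=
  h'.eq_of_mem h.mem_target h.mem_source

/-- Breaks attached to the two ends of a glued break, on the same side, have distinct vertices. -/
theorem IsForestPath.meet_ne_of_ends {H : Higraph V} {r : RawPath V} (hr : IsForestPath H r)
    {e p p' : ℕ × ℕ} (he : e ∈ r.arrows) (hp : p ∈ r.arrows) (hp' : p' ∈ r.arrows)
    (hpe : p ≠ e) (hpe' : p' ≠ e) {K K' : V} (hK : MeetAt (r.label p.1) (r.label p.2) K)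
    (hK' : MeetAt (r.label p'.1) (r.label p'.2) K')
    (h : p.1 = e.1 ∧ p'.1 = e.2 ∨ p.2 = e.1 ∧ p'.2 = e.2) : K ≠ K' := by
  obtain ⟨L, hL⟩ := hr.meet e he
  rintro rfl
  rcases h with ⟨h, h'⟩ | ⟨h, h'⟩
  · have hKL := hr.meet_ne p hp e he hpe (Or.inl h) K L hK hL
    exact hL.notMem_target (h ▸ hK.mem_target) hKL (h' ▸ hK'.mem_target)
  · have hKL := hr.meet_ne p' hp' e he hpe' (Or.inr h') K L hK' hL
    exact hL.notMem_source (h ▸ hK.mem_source) hKL (h' ▸ hK'.mem_source)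

theorem IsForestPath.glue {H : Higraph V} {r : RawPath V} (hr : IsForestPath H r)
    {e : ℕ × ℕ} (he : e ∈ r.arrows) : IsForestPath H (glue r e) where
  mem_nodes := hr.glue_mem_nodes he
  forest := hr.forest.image_pushBrk he
  label_mem v hv := hr.glue_label_mem he v (Finset.mem_of_mem_erase hv)
  meet := by
    intro q hq
    obtain ⟨p, hp, rfl⟩ := Finset.mem_image.1 hq
    obtain ⟨hpe, hp⟩ := Finset.mem_erase.1 hp
    obtain ⟨K, hK⟩ := hr.meet p hp
    exact ⟨K, hr.meetAt_glue he hp hpe hK⟩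
  meet_ne := by
    intro q hq q' hq' hne h L L' hL hL'
    obtain ⟨p, hp, rfl⟩ := Finset.mem_image.1 hq
    obtain ⟨p', hp', rfl⟩ := Finset.mem_image.1 hq'
    obtain ⟨hpe, hp⟩ := Finset.mem_erase.1 hp
    obtain ⟨hpe', hp'⟩ := Finset.mem_erase.1 hp'
    obtain ⟨K, hK⟩ := hr.meet p hp
    obtain ⟨K', hK'⟩ := hr.meet p' hp'
    obtain rfl := (hr.meetAt_glue he hp hpe hK).unique hL
    obtain rfl := (hr.meetAt_glue he hp' hpe' hK').unique hL'
    by_cases hpp : p.1 = p'.1 ∨ p.2 = p'.2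
    · exact hr.meet_ne p hp p' hp' (by rintro rfl; exact hne rfl) hpp K K' hK hK'
    · have hends : (p.1 = e.1 ∧ p'.1 = e.2 ∨ p.2 = e.1 ∧ p'.2 = e.2) ∨
          (p'.1 = e.1 ∧ p.1 = e.2 ∨ p'.2 = e.1 ∧ p.2 = e.2) := by
        simp only at h
        grind
      rcases hends with h | h
      · exact hr.meet_ne_of_ends he hp hp' hpe hpe' hK hK' h
      · exact (hr.meet_ne_of_ends he hp' hp hpe' hpe hK' hK h).symm

theorem IsRelabeling.glueIter {H : Higraph V} {σ : Equiv.Perm ℕ} {r r' : RawPath V}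
    (hr : IsForestPath H r) (h : IsRelabeling σ r r') {s : List (ℕ × ℕ)}
    (hs : IsGlueSeq r s) :
    IsRelabeling σ (glueIter r s) (glueIter r' (s.map (Prod.map σ σ))) := by
  induction s generalizing r r' with
  | nil => exact h
  | cons e s ih =>
    have he := hr.mem_nodes e hs.1
    exact ih (hr.glue hs.1) (h.glue he.1 he.2) hs.2

/-! ### Exchanging two gluings -/

/-- The map on nodes contracting the arrow `e` to its first node. -/
def contract (e : ℕ × ℕ) (x : ℕ) : ℕ := if x = e.2 then e.1 else x

theorem glue_nodes {r : RawPath V} {e : ℕ × ℕ} (h : e.1 ∈ r.nodes) (hne : e.1 ≠ e.2) :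
    (glue r e).nodes = r.nodes.image (contract e) := by
  ext x
  simp only [glue, contract, Finset.mem_erase, Finset.mem_image]
  grind

/-- The permutation of node names comparing the two orders of gluing at `e` and `f`. -/
def exchangePerm (e f : ℕ × ℕ) : Equiv.Perm ℕ :=
  if e.2 = f.2 then Equiv.swap e.1 f.1 else Equiv.refl ℕ

theorem exchangePerm_contract {A : Finset (ℕ × ℕ)} (hA : BridgeForest A) {e f : ℕ × ℕ}
    (he : e ∈ A) (hf : f ∈ A) (hne : e ≠ f) (x : ℕ) :
    exchangePerm e f (contract (pushBrk e f) (contract e x)) =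
      contract (pushBrk f e) (contract f x) := by
  have h₁ := hA.fst_ne_snd he
  have h₂ := hA.fst_ne_snd hf
  have h₃ : f.1 = e.2 → f.2 ≠ e.1 := hA.ne_swap he hf
  have h₄ : e.1 = f.1 → e.2 ≠ f.2 := fun h h' => hne (Prod.ext h h')
  obtain ⟨a, b⟩ := e
  obtain ⟨c, d⟩ := f
  simp only [pushBrk, contract, exchangePerm] at *
  by_cases hbd : b = d
  · simp only [hbd, if_true, Equiv.swap_apply_def]
    grind
  · simp only [hbd, if_false, Equiv.refl_apply]
    grind

theorem exchangePerm_pushBrk {A : Finset (ℕ × ℕ)} (hA : BridgeForest A) {e f : ℕ × ℕ}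
    (he : e ∈ A) (hf : f ∈ A) (hne : e ≠ f) (p : ℕ × ℕ) :
    Prod.map (exchangePerm e f) (exchangePerm e f) (pushBrk (pushBrk e f) (pushBrk e p)) =
      pushBrk (pushBrk f e) (pushBrk f p) :=
  Prod.ext (exchangePerm_contract hA he hf hne p.1) (exchangePerm_contract hA he hf hne p.2)

theorem BridgeForest.image_erase_image_erase {A : Finset (ℕ × ℕ)} (hA : BridgeForest A)
    {e f : ℕ × ℕ} (he : e ∈ A) (hf : f ∈ A) (hne : f ≠ e) :
    ((A.erase e).image (pushBrk e)).erase (pushBrk e f) =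
      ((A.erase e).erase f).image (pushBrk e) := by
  have hinj := hA.pushBrk_injOn he
  have hf' : f ∈ A.erase e := Finset.mem_erase.2 ⟨hne, hf⟩
  ext q
  simp only [Finset.mem_erase (s := Finset.image _ _), Finset.mem_image,
    Finset.mem_erase (b := f)]
  constructor
  · rintro ⟨hq, p, hp, rfl⟩
    exact ⟨p, ⟨by rintro rfl; exact hq rfl, hp⟩, rfl⟩
  · rintro ⟨p, ⟨hpf, hp⟩, rfl⟩
    exact ⟨fun h => hpf (hinj hp hf' h), p, hp, rfl⟩

theorem IsForestPath.exchange_label {H : Higraph V} {r : RawPath V} (hr : IsForestPath H r)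
    {e f : ℕ × ℕ} (he : e ∈ r.arrows) (hf : f ∈ r.arrows) (hne : e ≠ f) (v : ℕ)
    (hv : v ∈ (_root_.glue (_root_.glue r e) (pushBrk e f)).nodes) :
    (_root_.glue (_root_.glue r f) (pushBrk f e)).label (exchangePerm e f v) =
      (_root_.glue (_root_.glue r e) (pushBrk e f)).label v := by
  have h₁ := hr.forest.fst_ne_snd he
  have h₂ := hr.forest.fst_ne_snd hf
  have h₃ : f.1 = e.2 → f.2 ≠ e.1 := hr.forest.ne_swap he hf
  obtain ⟨K, hK⟩ := hr.meet e he
  obtain ⟨L, hL⟩ := hr.meet f hf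
  have hKL := fun h => hr.meet_ne e he f hf hne h K L hK hL
  have hL' := hr.meetAt_glue he hf hne.symm hL
  have hK' := hr.meetAt_glue hf he hne hK
  obtain ⟨a, b⟩ := e
  obtain ⟨c, d⟩ := f
  have hvb : v ≠ b := Finset.ne_of_mem_erase (Finset.mem_of_mem_erase hv)
  have hvd : v ≠ if d = b then a else d := Finset.ne_of_mem_erase hv
  clear hv he hf hr
  simp only [pushBrk, glue_label, exchangePerm] at *
  by_cases hbd : b = d
  · subst hbd
    have hac : a ≠ c := fun h => hne (by rw [h])
    have hca := hac.symm
    simp only [if_true, h₁, h₂, hac, hca, if_false, Equiv.swap_apply_def] at *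
    have := gluedEdge_left_comm (hKL (by simp)) hK hL hL' hK'
    split_ifs <;> simp_all
  · by_cases hac : a = c
    · subst hac
      have hdb := Ne.symm hbd
      simp only [if_true, h₁, h₂, h₁.symm, h₂.symm, hbd, hdb, if_false, Equiv.refl_apply] at *
      have := gluedEdge_right_comm (hKL (by simp)) hK hL hL' hK'
      split_ifs <;> simp_all
    · by_cases hcb : c = b
      · subst hcb
        have := gluedEdge_assoc hK hL
        grind
      · by_cases hda : d = a
        · subst hda
          have := gluedEdge_assoc hL hK
          grind
        · grind

theorem IsForestPath.exchange {H : Higraph V} {r : RawPath V} (hr : IsForestPath H r)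
    {e f : ℕ × ℕ} (he : e ∈ r.arrows) (hf : f ∈ r.arrows) (hne : e ≠ f) :
    IsRelabeling (exchangePerm e f) (_root_.glue (_root_.glue r e) (pushBrk e f))
      (_root_.glue (_root_.glue r f) (pushBrk f e)) := by
  have hef := pushBrk_mem_glue hf hne.symm
  have hfe := pushBrk_mem_glue he hne
  have hre := hr.glue he
  have hrf := hr.glue hf
  refine ⟨?_, ?_, fun v hv => ?_⟩
  · rw [glue_nodes (hre.mem_nodes _ hef).1 (hre.forest.fst_ne_snd hef),
      glue_nodes (hrf.mem_nodes _ hfe).1 (hrf.forest.fst_ne_snd hfe),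
      glue_nodes (hr.mem_nodes _ he).1 (hr.forest.fst_ne_snd he),
      glue_nodes (hr.mem_nodes _ hf).1 (hr.forest.fst_ne_snd hf),
      Finset.image_image, Finset.image_image, Finset.image_image]
    exact Finset.image_congr fun x _ => (exchangePerm_contract hr.forest he hf hne x).symm
  · simp only [glue_arrows]
    rw [hr.forest.image_erase_image_erase he hf hne.symm,
      hr.forest.image_erase_image_erase hf he hne, Finset.image_image, Finset.image_image,
      Finset.image_image, Finset.erase_right_comm]
    exact Finset.image_congr fun p _ => (exchangePerm_pushBrk hr.forest he hf hne p).symm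
  · exact hr.exchange_label he hf hne v hv

theorem IsForestPath.rawIso_of_perm {H : Higraph V} {l₁ l₂ : List (ℕ × ℕ)} (h : l₁.Perm l₂) :
    ∀ {r : RawPath V}, IsForestPath H r → IsBreakList r l₁ →
      RawIso (glueIter r (toSeq l₁)) (glueIter r (toSeq l₂)) := by
  induction hn : l₁.length generalizing l₁ l₂ with
  | zero =>
    obtain rfl := List.length_eq_zero_iff.1 hn
    obtain rfl := h.nil_eq
    exact fun _ _ => RawIso.refl _
  | succ n ih =>
    induction h with
    | nil => simp at hn
    | @cons e l₁ l₂ h _ =>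
      intro r hr hl
      rw [toSeq_cons, toSeq_cons]
      exact ih (h.map _) (by simpa using hn) (hr.glue (hl.2 e (by simp)))
        (hl.map_pushBrk hr.forest)
    | swap e f l =>
      intro r hr hl
      have hf : f ∈ r.arrows := hl.2 f (by simp)
      have he : e ∈ r.arrows := hl.2 e (by simp)
      have hne : f ≠ e := fun h => (List.nodup_cons.1 hl.1).1 (by simp [h])
      have hex := hr.exchange hf he hne
      have hlf := hl.map_pushBrk hr.forest
      have hgf := hr.glue hf
      have hef : pushBrk f e ∈ (_root_.glue r f).arrows := pushBrk_mem_glue he hne.symm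
      have hl' := hlf.map_pushBrk hgf.forest
      have key := (hex.glueIter (hgf.glue hef)
        (hl'.isGlueSeq_toSeq (hgf.glue hef).forest)).rawIso
      have hmap : ((l.map (pushBrk f)).map (pushBrk (pushBrk f e))).map
          (Prod.map (exchangePerm f e) (exchangePerm f e)) =
            (l.map (pushBrk e)).map (pushBrk (pushBrk e f)) := by
        rw [List.map_map, List.map_map, List.map_map]
        exact List.map_congr_left fun p _ => exchangePerm_pushBrk hr.forest hf he hne p
      rw [← toSeq_map_prodMap, hmap] at key
      simp only [toSeq_cons, List.map_cons]
      exact key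
    | trans h h' ih₁ ih₂ =>
      intro r hr hl
      exact (ih₁ hn hr hl).trans (ih₂ (h.length_eq ▸ hn) hr
        ⟨h.nodup_iff.1 hl.1, fun e he => hl.2 e (h.mem_iff.2 he)⟩)

/-- For a path `ρ₁` in a higraph and `k ≥ 1`, the pushforward map is a
bijection between `k`-tuples of distinct breaks on `ρ₁` and `k`-step gluing sequences on
`ρ₁`; and if two `k`-tuples of distinct breaks differ by a permutation, then the
corresponding `k`-step gluing sequences terminate in the same path. -/
theorem pushforward_bijection_gluing_sequences
    (H : Higraph V) (ρ : RawPath V) (hρ : IsPath H ρ) (k : ℕ) (hk : 1 ≤ k) :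
    Set.BijOn toSeq
      {l : List (ℕ × ℕ) | l.length = k ∧ l.Nodup ∧ ∀ e ∈ l, e ∈ ρ.arrows}
      {l : List (ℕ × ℕ) | l.length = k ∧ IsGlueSeq ρ l} ∧
    (∀ l₁ l₂ : List (ℕ × ℕ),
      (l₁.length = k ∧ l₁.Nodup ∧ ∀ e ∈ l₁, e ∈ ρ.arrows) →
      (l₂.length = k ∧ l₂.Nodup ∧ ∀ e ∈ l₂, e ∈ ρ.arrows) →
      l₁.Perm l₂ →
      RawIso (glueIter ρ (toSeq l₁)) (glueIter ρ (toSeq l₂))) := by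
  have hr := hρ.isForestPath
  refine ⟨⟨?_, ?_, ?_⟩, ?_⟩
  · rintro l ⟨hlen, hl⟩
    exact ⟨(length_toSeq l).trans hlen, IsBreakList.isGlueSeq_toSeq hr.forest hl⟩
  · rintro l₁ ⟨-, h₁⟩ l₂ ⟨-, h₂⟩ h
    exact IsBreakList.toSeq_inj hr.forest h₁ h₂ h
  · rintro s ⟨hlen, hs⟩
    obtain ⟨l, hl, rfl⟩ := exists_toSeq_eq hr.forest hs
    exact ⟨l, ⟨(length_toSeq l).symm.trans hlen, hl⟩, rfl⟩
  · rintro l₁ l₂ ⟨-, h₁⟩ - hperm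
    exact IsForestPath.rawIso_of_perm hperm hr h₁
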